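/- arXiv:1010.2475 — 2 statements merged into one kernel-verified Lean document; each statement's English description precedes it below -/
import Mathlib

section
/- For every λ > 0 and every x ∈ ℝ² \ {0}, the Biot–Savart integral of the Gaussian vorticity equals the explicit velocity field: (1/(2π)) ∫_{ℝ²} ((x−y)^⊥/|x−y|²) φ₀₀(y;λ) dy = (1/(2π)) ((−x₂,x₁)/|x|²)(1 − exp(−|x|²/λ²)), where z^⊥ = (−z₂, z₁) for z = (z₁,z₂). -/
open MeasureTheory Real

/-- first partial derivative `∂_{x₁}` of a function on `ℝ²`. -/
noncomputable def pd1 (f : ℝ × ℝ → ℝ) : ℝ × ℝ → ℝ := fun x => deriv (fun s => f (s, x.2)) x.1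

/-- second partial derivative `∂_{x₂}` of a function on `ℝ²`. -/
noncomputable def pd2 (f : ℝ × ℝ → ℝ) : ℝ × ℝ → ℝ := fun x => deriv (fun s => f (x.1, s)) x.2

/-- mixed partial derivative `∂^{k₁}_{x₁} ∂^{k₂}_{x₂}`. -/
noncomputable def md (k1 k2 : ℕ) (f : ℝ × ℝ → ℝ) : ℝ × ℝ → ℝ := pd1^[k1] (pd2^[k2] f)

/-- the Gaussian vorticity `φ₀₀(x;λ) = (1/(πλ²)) exp(−|x|²/λ²)`. -/
noncomputable def phi00 (lam : ℝ) (x : ℝ × ℝ) : ℝ :=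
  (1 / (π * lam ^ 2)) * Real.exp (-(x.1 ^ 2 + x.2 ^ 2) / lam ^ 2)

/-- first component of the Lamb–Oseen velocity field `V₀₀(x;λ)`. -/
noncomputable def V001 (lam : ℝ) (x : ℝ × ℝ) : ℝ :=
  (1 / (2 * π)) * (-x.2 / (x.1 ^ 2 + x.2 ^ 2)) * (1 - Real.exp (-(x.1 ^ 2 + x.2 ^ 2) / lam ^ 2))

/-- second component of the Lamb–Oseen velocity field `V₀₀(x;λ)`. -/
noncomputable def V002 (lam : ℝ) (x : ℝ × ℝ) : ℝ :=
  (1 / (2 * π)) * (x.1 / (x.1 ^ 2 + x.2 ^ 2)) * (1 - Real.exp (-(x.1 ^ 2 + x.2 ^ 2) / lam ^ 2))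

/-- two-dimensional Hermite polynomial `H_{n₁,n₂}(z;λ)` defined via the generating function. -/
noncomputable def hpoly (lam : ℝ) (n1 n2 : ℕ) (z : ℝ × ℝ) : ℝ :=
  md n1 n2 (fun τ => Real.exp ((2 * (τ.1 * z.1 + τ.2 * z.2) - (τ.1 ^ 2 + τ.2 ^ 2)) / lam ^ 2)) (0, 0)

/-- Hermite function `φ_{k₁,k₂}(x;λ) = ∂^{k₁}_{x₁} ∂^{k₂}_{x₂} φ₀₀(x;λ)`. -/
noncomputable def hfun (lam : ℝ) (k1 k2 : ℕ) : ℝ × ℝ → ℝ := md k1 k2 (phi00 lam)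

/-- The average of the Cauchy kernel `(z - w)⁻¹` over a circle centered at the origin. -/
lemma circleAverage_sub_inv {z : ℂ} {r : ℝ} (hr : 0 < r) (hrz : r ≠ ‖z‖) :
    circleAverage (fun w => (z - w)⁻¹) 0 r = if r < ‖z‖ then z⁻¹ else 0 := by
  split_ifs with h
  · have hd : DiffContOnCl ℂ (fun w => (z - w)⁻¹) (Metric.ball 0 |r|) := by
      apply DifferentiableOn.diffContOnCl
      rw [abs_of_pos hr, closure_ball _ hr.ne']
      intro w hw
      have : z - w ≠ 0 := by
        rintro h0
        rw [sub_eq_zero] at h0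
        subst h0
        simp at hw
        linarith
      exact (DifferentiableAt.inv (by fun_prop) this).differentiableWithinAt
    simpa using hd.circleAverage
  · have hzr : ‖z‖ < r := lt_of_le_of_ne (not_lt.1 h) hrz.symm
    rw [circleAverage_eq_circleIntegral hr.ne']
    have hz : z ∈ Metric.ball (0 : ℂ) r := by simpa using hzr
    have h0 : (0 : ℂ) ∈ Metric.ball (0 : ℂ) r := by simpa using hr
    have hne : ∀ w ∈ Metric.sphere (0 : ℂ) r, w ≠ 0 ∧ w - z ≠ 0 := by
      intro w hw
      have hw' : ‖w‖ = r := by simpa using hw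
      constructor
      · rintro rfl
        simp at hw'
        linarith
      · intro h1
        rw [sub_eq_zero] at h1
        subst h1
        linarith
    by_cases hz0 : z = 0
    · subst hz0
      have : (∮ w in C(0, r), (w - 0)⁻¹ • ((0 : ℂ) - w)⁻¹) =
          ∮ w in C(0, r), (-1 : ℂ) • (w - 0) ^ (-2 : ℤ) := by
        refine circleIntegral.integral_congr hr.le fun w hw => ?_
        have hw0 := (hne w hw).1
        simp only [zero_sub, sub_zero, smul_eq_mul, zpow_neg, zpow_ofNat]
        field_simp
      rw [this, circleIntegral.integral_smul,
        circleIntegral.integral_sub_zpow_of_ne (by norm_num)]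
      simp
    · have : (∮ w in C(0, r), (w - 0)⁻¹ • (z - w)⁻¹) =
          ∮ w in C(0, r), z⁻¹ • ((w - 0)⁻¹ - (w - z)⁻¹) := by
        refine circleIntegral.integral_congr hr.le fun w hw => ?_
        obtain ⟨h1, h2⟩ := hne w hw
        have h3 : z - w ≠ 0 := by rwa [← neg_sub, neg_ne_zero]
        simp only [smul_eq_mul, sub_zero]
        field_simp
        ring
      rw [this, circleIntegral.integral_smul, circleIntegral.integral_sub,
        circleIntegral.integral_sub_inv_of_mem_ball h0,
        circleIntegral.integral_sub_inv_of_mem_ball hz]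
      · simp
      · refine ContinuousOn.circleIntegrable hr.le ?_
        exact ContinuousOn.inv₀ (by fun_prop) fun w hw => by simpa using (hne w hw).1
      · refine ContinuousOn.circleIntegrable hr.le ?_
        exact ContinuousOn.inv₀ (by fun_prop) fun w hw => (hne w hw).2

lemma setIntegral_polarCoord_symm_eq_circleAverage (f : ℂ → ℂ) (r : ℝ) :
    ∫ θ in Set.Ioo (-π) π, f (Complex.polarCoord.symm (r, θ)) =
      (2 * π : ℝ) • circleAverage f 0 r := by
  have hper : Function.Periodic (fun θ => f (circleMap 0 r θ)) (2 * π) :=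
    (periodic_circleMap 0 r).comp f
  have := hper.intervalIntegral_add_eq (-π) 0
  rw [show -π + 2 * π = π by ring, zero_add] at this
  rw [circleAverage_def, smul_inv_smul₀ (by positivity), ← this,
    intervalIntegral.integral_of_le (by linarith [pi_pos]), integral_Ioc_eq_integral_Ioo]
  congr with θ
  simp [circleMap, Complex.exp_mul_I]

/-- Integrability is preserved by passing to polar coordinates. -/
lemma integrableOn_comp_polarCoord_symm {f : ℂ → ℂ} (hf : Integrable f) :
    IntegrableOn (fun p => p.1 • f (Complex.polarCoord.symm p))
      (Set.Ioi (0 : ℝ) ×ˢ Set.Ioo (-π) π) := by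
  have h1 : Integrable (f ∘ Complex.measurableEquivRealProd.symm) :=
    (Complex.volume_preserving_equiv_real_prod.symm).integrable_comp_of_integrable hf
  have h2 := (integrableOn_image_iff_integrableOn_abs_det_fderiv_smul volume
    polarCoord.open_target.measurableSet
    (fun p _ => (hasFDerivAt_polarCoord_symm p).hasFDerivWithinAt)
    polarCoord.symm.injOn (f ∘ Complex.measurableEquivRealProd.symm)).1 h1.integrableOn
  refine h2.congr_fun (fun p hp => ?_) polarCoord.open_target.measurableSet
  simp only [det_fderivPolarCoordSymm, abs_of_pos (Set.mem_Ioi.1 hp.1)]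
  rfl

lemma integral_radial_mul_sub_inv {g : ℝ → ℝ} {z : ℂ}
    (hg : Integrable fun w : ℂ => (g ‖w‖ : ℂ) * (z - w)⁻¹) :
    ∫ w : ℂ, (g ‖w‖ : ℂ) * (z - w)⁻¹ =
      ((∫ r in (0 : ℝ)..‖z‖, 2 * π * r * g r : ℝ) : ℂ) * z⁻¹ := by
  have hinner : ∀ r ∈ Set.Ioi (0 : ℝ), ∫ θ in Set.Ioo (-π) π,
      (r • ((g ‖Complex.polarCoord.symm (r, θ)‖ : ℂ) * (z - Complex.polarCoord.symm (r, θ))⁻¹)) =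
      (2 * π * r * g r : ℝ) • circleAverage (fun w => (z - w)⁻¹) 0 r := by
    intro r hr
    simp only [Complex.norm_polarCoord_symm, abs_of_pos (Set.mem_Ioi.1 hr)]
    rw [integral_smul, integral_const_mul,
      setIntegral_polarCoord_symm_eq_circleAverage (fun w => (z - w)⁻¹)]
    simp only [Complex.real_smul]
    push_cast
    ring
  have hae : ∀ᵐ r : ℝ, r ∈ Set.Ioi (0 : ℝ) →
      (2 * π * r * g r : ℝ) • circleAverage (fun w => (z - w)⁻¹) 0 r =
      (Set.Iio ‖z‖).indicator (fun r => ((2 * π * r * g r : ℝ) : ℂ) * z⁻¹) r := by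
    have : ∀ᵐ r : ℝ, r ≠ ‖z‖ := by simp [ae_iff]
    filter_upwards [this] with r hr hr0
    rw [circleAverage_sub_inv hr0 hr]
    by_cases h : r < ‖z‖ <;> simp [h]
  rw [← Complex.integral_comp_polarCoord_symm, polarCoord_target, Measure.volume_eq_prod,
    setIntegral_prod _ (integrableOn_comp_polarCoord_symm hg),
    setIntegral_congr_fun measurableSet_Ioi hinner,
    setIntegral_congr_ae measurableSet_Ioi hae,
    setIntegral_indicator measurableSet_Iio, Set.Ioi_inter_Iio, integral_mul_const,
    integral_complex_ofReal, intervalIntegral.integral_of_le (norm_nonneg z),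
    integral_Ioc_eq_integral_Ioo]

lemma integrable_gaussian_mul_sub_inv {b : ℝ} (hb : 0 < b) (z : ℂ) :
    Integrable fun w : ℂ => (rexp (-b * ‖w‖ ^ 2) : ℂ) * (z - w)⁻¹ := by
  have hrad : Integrable fun v : ℂ => ‖v‖⁻¹ * rexp (-(b / 2) * ‖v‖ ^ 2) := by
    rw [integrable_fun_norm_addHaar volume (f := fun y : ℝ => y⁻¹ * rexp (-(b / 2) * y ^ 2))]
    refine (integrable_exp_neg_mul_sq (half_pos hb)).integrableOn.congr_fun
      (fun y hy => ?_) measurableSet_Ioi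
    have : y ≠ 0 := (Set.mem_Ioi.1 hy).ne'
    simp [this]
  refine ((hrad.comp_sub_left z).const_mul (rexp (b * ‖z‖ ^ 2))).mono'
    (by fun_prop) (ae_of_all _ fun w => ?_)
  have hsq : ‖z - w‖ ^ 2 ≤ 2 * ‖z‖ ^ 2 + 2 * ‖w‖ ^ 2 := by
    nlinarith [norm_sub_le z w, norm_nonneg (z - w), norm_nonneg z, norm_nonneg w,
      sq_nonneg (‖z‖ - ‖w‖)]
  have hexp : rexp (-b * ‖w‖ ^ 2) ≤ rexp (b * ‖z‖ ^ 2) * rexp (-(b / 2) * ‖z - w‖ ^ 2) := by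
    rw [← Real.exp_add, Real.exp_le_exp]
    nlinarith
  rw [norm_mul, norm_inv, Complex.norm_real, Real.norm_eq_abs, abs_of_pos (Real.exp_pos _)]
  calc _ ≤ (rexp (b * ‖z‖ ^ 2) * rexp (-(b / 2) * ‖z - w‖ ^ 2)) * ‖z - w‖⁻¹ := by gcongr
    _ = _ := by ring

lemma integral_mul_gaussian {b : ℝ} (hb : b ≠ 0) (R : ℝ) :
    ∫ r in (0 : ℝ)..R, 2 * π * r * rexp (-b * r ^ 2) = π / b * (1 - rexp (-b * R ^ 2)) := by
  have hderiv : ∀ r ∈ Set.uIcc 0 R, HasDerivAt (fun r => -(π / b) * rexp (-b * r ^ 2))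
      (2 * π * r * rexp (-b * r ^ 2)) r := by
    intro r _
    have h := (((hasDerivAt_pow 2 r).const_mul (-b)).exp).const_mul (-(π / b))
    refine h.congr_deriv ?_
    norm_num
    field_simp
  rw [intervalIntegral.integral_eq_sub_of_hasDerivAt hderiv
    (Continuous.intervalIntegrable (by fun_prop) _ _)]
  simp
  ring

/-- The Cauchy transform of a Gaussian on the plane. -/
lemma integral_gaussian_mul_sub_inv {b : ℝ} (hb : 0 < b) (z : ℂ) :
    ∫ w : ℂ, (rexp (-b * ‖w‖ ^ 2) : ℂ) * (z - w)⁻¹ =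
      ((π / b * (1 - rexp (-b * ‖z‖ ^ 2)) : ℝ) : ℂ) * z⁻¹ := by
  rw [← integral_mul_gaussian hb.ne']
  exact integral_radial_mul_sub_inv (g := fun r => rexp (-b * r ^ 2))
    (integrable_gaussian_mul_sub_inv hb z)

lemma integral_real_prod_eq_integral_complex (f : ℂ → ℂ) :
    ∫ y : ℝ × ℝ, f ⟨y.1, y.2⟩ = ∫ w : ℂ, f w :=
  (Complex.volume_preserving_equiv_real_prod.symm).integral_comp
    Complex.measurableEquivRealProd.symm.measurableEmbedding f

lemma integrable_real_prod_of_integrable_complex {f : ℂ → ℂ} (hf : Integrable f) :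
    Integrable fun y : ℝ × ℝ => f ⟨y.1, y.2⟩ :=
  (Complex.volume_preserving_equiv_real_prod.symm).integrable_comp_of_integrable hf

lemma norm_mk_sq (a b : ℝ) : ‖(⟨a, b⟩ : ℂ)‖ ^ 2 = a ^ 2 + b ^ 2 := by
  rw [Complex.sq_norm, Complex.normSq_mk]
  ring

/-- the Biot–Savart integral of the Gaussian vorticity equals the explicit
Lamb–Oseen velocity field. -/
theorem biot_savart_of_gaussian (lam : ℝ) (hlam : 0 < lam) (x : ℝ × ℝ) (hx : x ≠ 0) :
    ((1 / (2 * π)) * ∫ y : ℝ × ℝ,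
        (-(x.2 - y.2) / ((x.1 - y.1) ^ 2 + (x.2 - y.2) ^ 2)) * phi00 lam y) = V001 lam x ∧
    ((1 / (2 * π)) * ∫ y : ℝ × ℝ,
        ((x.1 - y.1) / ((x.1 - y.1) ^ 2 + (x.2 - y.2) ^ 2)) * phi00 lam y) = V002 lam x := by
  set b : ℝ := 1 / lam ^ 2 with hb
  have hb0 : 0 < b := by positivity
  set z : ℂ := ⟨x.1, x.2⟩ with hz
  set F : ℝ × ℝ → ℂ := fun y =>
    (rexp (-b * ‖(⟨y.1, y.2⟩ : ℂ)‖ ^ 2) : ℂ) * (z - ⟨y.1, y.2⟩)⁻¹ with hF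
  have hFint : Integrable F :=
    integrable_real_prod_of_integrable_complex (integrable_gaussian_mul_sub_inv hb0 z)
  have hFval : ∫ y, F y = ((π / b * (1 - rexp (-b * ‖z‖ ^ 2)) : ℝ) : ℂ) * z⁻¹ :=
    (integral_real_prod_eq_integral_complex _).trans (integral_gaussian_mul_sub_inv hb0 z)
  have hphi : ∀ y : ℝ × ℝ, phi00 lam y = b / π * rexp (-b * (y.1 ^ 2 + y.2 ^ 2)) := by
    intro y
    rw [phi00, hb]
    congr 1
    · field_simp
    · congr 1
      ring
  have hexp : -b * (x.1 ^ 2 + x.2 ^ 2) = -(x.1 ^ 2 + x.2 ^ 2) / lam ^ 2 := by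
    rw [hb]
    ring
  have hre : ∫ y, (F y).re = (∫ y, F y).re := integral_re hFint
  have him : ∫ y, (F y).im = (∫ y, F y).im := integral_im hFint
  constructor
  · have h : ∀ y : ℝ × ℝ, (-(x.2 - y.2) / ((x.1 - y.1) ^ 2 + (x.2 - y.2) ^ 2)) * phi00 lam y =
        b / π * (F y).im := by
      intro y
      rw [hphi]
      simp only [hF, norm_mk_sq, Complex.im_ofReal_mul, Complex.inv_im, Complex.normSq_apply, hz,
        Complex.sub_re, Complex.sub_im]
      ring
    simp_rw [h]
    rw [integral_const_mul, him, hFval, Complex.im_ofReal_mul, Complex.inv_im, norm_mk_sq,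
      Complex.normSq_mk, V001, hexp]
    simp only [hz]
    field_simp
  · have h : ∀ y : ℝ × ℝ, ((x.1 - y.1) / ((x.1 - y.1) ^ 2 + (x.2 - y.2) ^ 2)) * phi00 lam y =
        b / π * (F y).re := by
      intro y
      rw [hphi]
      simp only [hF, norm_mk_sq, Complex.re_ofReal_mul, Complex.inv_re, Complex.normSq_apply, hz,
        Complex.sub_re, Complex.sub_im]
      ring
    simp_rw [h]
    rw [integral_const_mul, hre, hFval, Complex.re_ofReal_mul, Complex.inv_re, norm_mk_sq,
      Complex.normSq_mk, V002, hexp]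
    simp only [hz]
    field_simp
end

section
/- For every λ > 0 and all nonnegative integers k₁, k₂, ℓ₁, ℓ₂, m₁, m₂, the quantity Γᴵ = ∫_{ℝ²} (D^{m₁}_{x₁} D^{m₂}_{x₂} V₀₀¹(x;λ)) (∂_{x₁} H_{k₁,k₂}(x;λ)) (D^{ℓ₁}_{x₁} D^{ℓ₂}_{x₂} φ₀₀(x;λ)) dx equals the finite combinatorial double sum ∑_{i=0}^{min(ℓ₁,k₁−1)} ∑_{j=0}^{min(ℓ₂,k₂)} C(ℓ₁,i) C(ℓ₂,j) (−1)^{ℓ₁+ℓ₂} (2^{i+1} k₁! / (λ^{2(i+1)} (k₁−i−1)!)) (2^{j} k₂! / (λ^{2j} (k₂−j)!)) · ℋ₁(m₁+k₁−i−1+ℓ₁−i, m₂+k₂−j+ℓ₂−j). -/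
open MeasureTheory Real

/-- explicit combinatorial expression `ℋ₁(α₁,α₂)` from the paper. -/
noncomputable def Hone (lam : ℝ) (a1 a2 : ℕ) : ℝ :=
  if Even a1 ∧ Odd a2 then
    (-1 / (2 * π)) * (1 / (2 * lam ^ 2)) ^ ((a1 + a2 + 1) / 2)
      * ((-1 : ℝ) ^ ((a1 + a2 - 1) / 2) / (Nat.factorial ((a1 + a2 + 1) / 2) : ℝ))
      * (Nat.choose ((a1 + a2 - 1) / 2) (a1 / 2) : ℝ)
      * (Nat.factorial a1 : ℝ) * (Nat.factorial a2 : ℝ)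
  else 0

/-- The `n`-th derivative of `x ↦ exp (-t * x ^ 2)`. -/
noncomputable def gaussDeriv (t : ℝ) : ℕ → ℝ → ℝ
  | 0, x => Real.exp (-t * x ^ 2)
  | 1, x => -2 * t * x * Real.exp (-t * x ^ 2)
  | n + 2, x => -2 * t * x * gaussDeriv t (n + 1) x - 2 * t * (n + 1) * gaussDeriv t n x

lemma gaussDeriv_zero (t x : ℝ) : gaussDeriv t 0 x = Real.exp (-t * x ^ 2) := by
  simp [gaussDeriv]

lemma gaussDeriv_succ (t : ℝ) (n : ℕ) (x : ℝ) :
    gaussDeriv t (n + 1) x =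
      -2 * t * x * gaussDeriv t n x - 2 * t * n * gaussDeriv t (n - 1) x := by
  cases n <;> simp [gaussDeriv]

lemma hasDerivAt_gaussDeriv (t : ℝ) (n : ℕ) (x : ℝ) :
    HasDerivAt (gaussDeriv t n) (gaussDeriv t (n + 1) x) x := by
  have h_exp : HasDerivAt (fun x => Real.exp (-t * x ^ 2)) (-2 * t * x * Real.exp (-t * x ^ 2)) x := by
    refine ((hasDerivAt_pow 2 x).const_mul (-t)).exp.congr_deriv ?_
    simp; ring
  induction n using Nat.twoStepInduction with
  | zero => simpa [gaussDeriv, funext (gaussDeriv_zero t)] using h_exp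
  | one =>
    have h := ((hasDerivAt_id x).const_mul (-2 * t)).mul h_exp
    have e : gaussDeriv t 1 = fun x => -2 * t * x * Real.exp (-t * x ^ 2) := by
      ext x; simp [gaussDeriv]
    rw [e]
    refine h.congr_deriv ?_
    simp [gaussDeriv]; ring
  | more n ih₀ ih₁ =>
    have h := (((hasDerivAt_id x).const_mul (-2 * t)).mul ih₁).sub
      (ih₀.const_mul (2 * t * (n + 1)))
    have e : gaussDeriv t (n + 2) = fun x =>
        -2 * t * x * gaussDeriv t (n + 1) x - 2 * t * (n + 1) * gaussDeriv t n x := by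
      ext x; simp [gaussDeriv]
    rw [e, gaussDeriv]
    refine h.congr_deriv ?_
    push_cast
    simp only [id]
    ring

lemma continuous_gaussDeriv_uncurry (n : ℕ) :
    Continuous fun p : ℝ × ℝ => gaussDeriv p.1 n p.2 := by
  induction n using Nat.twoStepInduction with
  | zero => simp only [gaussDeriv]; fun_prop
  | one => simp only [gaussDeriv]; fun_prop
  | more n ih₀ ih₁ => simp only [gaussDeriv]; fun_prop

@[fun_prop]
lemma Continuous.gaussDeriv {X : Type*} [TopologicalSpace X] {f g : X → ℝ}
    (hf : Continuous f) (hg : Continuous g) (n : ℕ) :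
    Continuous fun p => gaussDeriv (f p) n (g p) :=
  (continuous_gaussDeriv_uncurry n).comp (hf.prodMk hg)

lemma gaussDeriv_neg (t : ℝ) (n : ℕ) (x : ℝ) :
    gaussDeriv t n (-x) = (-1) ^ n * gaussDeriv t n x := by
  induction n using Nat.twoStepInduction with
  | zero => simp [gaussDeriv]
  | one => simp [gaussDeriv]
  | more n ih₀ ih₁ => simp only [gaussDeriv, ih₀, ih₁]; ring

/-- The `n`-th derivative of `x ↦ x * exp (-t * x ^ 2)`. -/
noncomputable def mulGaussDeriv (t : ℝ) (n : ℕ) (x : ℝ) : ℝ :=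
  x * gaussDeriv t n x + n * gaussDeriv t (n - 1) x

lemma hasDerivAt_mulGaussDeriv (t : ℝ) (n : ℕ) (x : ℝ) :
    HasDerivAt (mulGaussDeriv t n) (mulGaussDeriv t (n + 1) x) x := by
  have h := ((hasDerivAt_id x).mul (hasDerivAt_gaussDeriv t n x)).add
    ((hasDerivAt_gaussDeriv t (n - 1) x).const_mul (n : ℝ))
  refine h.congr_deriv ?_
  cases n <;> simp [mulGaussDeriv] <;> ring

@[fun_prop]
lemma Continuous.mulGaussDeriv {X : Type*} [TopologicalSpace X] {f g : X → ℝ}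
    (hf : Continuous f) (hg : Continuous g) (n : ℕ) :
    Continuous fun p => mulGaussDeriv (f p) n (g p) := by
  unfold _root_.mulGaussDeriv
  fun_prop

lemma gaussDeriv_succ_eq_mulGaussDeriv (t : ℝ) (n : ℕ) (x : ℝ) :
    gaussDeriv t (n + 1) x = -2 * t * mulGaussDeriv t n x := by
  rw [gaussDeriv_succ, mulGaussDeriv]; ring

/-- The one-dimensional Hermite polynomial with generating function `exp (c * (2 * τ * x - τ ^ 2))`. -/
noncomputable def hermiteOne (c : ℝ) (k : ℕ) (x : ℝ) : ℝ :=
  (-1) ^ k * Real.exp (c * x ^ 2) * gaussDeriv c k x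

lemma hasDerivAt_hermiteOne (c : ℝ) (k : ℕ) (x : ℝ) :
    HasDerivAt (hermiteOne c k) (2 * c * k * hermiteOne c (k - 1) x) x := by
  have h_exp : HasDerivAt (fun x => (-1) ^ k * Real.exp (c * x ^ 2))
      ((-1) ^ k * (2 * c * x * Real.exp (c * x ^ 2))) x := by
    refine (((hasDerivAt_pow 2 x).const_mul c).exp.const_mul ((-1) ^ k)).congr_deriv ?_
    simp; ring
  refine (h_exp.mul (hasDerivAt_gaussDeriv c k x)).congr_deriv ?_
  rw [gaussDeriv_succ]
  cases k <;> simp [hermiteOne] <;> ring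

/-- Linearization of the product of a Hermite polynomial and a derivative of the Gaussian. -/
lemma hermiteOne_mul_gaussDeriv (c : ℝ) (k l : ℕ) (x : ℝ) :
    hermiteOne c k x * gaussDeriv c l x =
      ∑ i ∈ Finset.range (l + 1), (l.choose i : ℝ) *
        ((-1) ^ k * (2 * c) ^ i * k.descFactorial i * gaussDeriv c (k - i + (l - i)) x) := by
  induction l generalizing k x with
  | zero =>
    have h_exp : Real.exp (c * x ^ 2) * Real.exp (-(c * x ^ 2)) = 1 := by
      rw [← Real.exp_add]; simp
    simp only [hermiteOne, gaussDeriv_zero, zero_add, Finset.range_one, Finset.sum_singleton]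
    simp
    linear_combination (-1) ^ k * gaussDeriv c k x * h_exp
  | succ l ih =>
    have h₁ := (hasDerivAt_hermiteOne c k x).mul (hasDerivAt_gaussDeriv c l x)
    have h₂ : HasDerivAt (hermiteOne c k * gaussDeriv c l)
        (∑ i ∈ Finset.range (l + 1), (l.choose i : ℝ) * ((-1) ^ k * (2 * c) ^ i *
          k.descFactorial i * gaussDeriv c (k - i + (l - i) + 1) x)) x := by
      rw [show hermiteOne c k * gaussDeriv c l = _ from funext (ih k)]
      exact HasDerivAt.fun_sum fun i _ =>
        ((hasDerivAt_gaussDeriv c _ x).const_mul _).const_mul _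
    have h₃ := h₁.unique h₂
    have h₄ := Finset.sum_choose_succ_mul (fun i j => (-1) ^ k * (2 * c) ^ i *
      k.descFactorial i * gaussDeriv c (k - i + j) x) l
    rw [h₄, Finset.sum_congr rfl fun i hi => by
      rw [show l + 1 - i = l - i + 1 by have := Finset.mem_range.1 hi; omega, ← add_assoc],
      ← h₃, mul_assoc (2 * c * k), ih, Finset.mul_sum, add_right_comm, right_eq_add,
      ← Finset.sum_add_distrib]
    refine Finset.sum_eq_zero fun i _ => ?_
    cases k with
    | zero => simp
    | succ k =>
      rw [Nat.succ_descFactorial_succ]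
      simp
      ring

lemma exists_abs_gaussDeriv_le {c : ℝ} (hc : 0 ≤ c) (n : ℕ) :
    ∃ C, 0 ≤ C ∧ ∀ t ∈ Set.Icc 0 c, ∀ x,
      |gaussDeriv t n x| ≤ C * (1 + x ^ 2) ^ n * Real.exp (-t * x ^ 2) := by
  have h_abs (x : ℝ) : |x| ≤ 1 + x ^ 2 := by
    rw [← sq_abs]; nlinarith [sq_nonneg (|x| - 1), abs_nonneg x]
  induction n using Nat.twoStepInduction with
  | zero => exact ⟨1, zero_le_one, fun t _ x => by simp [gaussDeriv]⟩
  | one =>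
    refine ⟨2 * c, by positivity, fun t ht x => ?_⟩
    have ht₀ := ht.1
    have ht₁ := ht.2
    simp only [gaussDeriv, abs_mul, abs_neg, Real.abs_exp, abs_of_nonneg ht₀, abs_two, pow_one]
    gcongr
    exact h_abs x
  | more n ih₀ ih₁ =>
    obtain ⟨C₀, hC₀, h₀⟩ := ih₀
    obtain ⟨C₁, hC₁, h₁⟩ := ih₁
    refine ⟨2 * c * C₁ + 2 * c * (n + 1) * C₀, by positivity, fun t ht x => ?_⟩
    have ht₀ := ht.1
    have ht₁ := ht.2
    set e := Real.exp (-t * x ^ 2)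
    have he : 0 < e := Real.exp_pos _
    have h_one : 1 ≤ 1 + x ^ 2 := by nlinarith [sq_nonneg x]
    calc |gaussDeriv t (n + 2) x|
        ≤ |2 * t * x * gaussDeriv t (n + 1) x| + |2 * t * (n + 1) * gaussDeriv t n x| := by
          rw [gaussDeriv]
          refine (abs_sub _ _).trans_eq ?_
          simp only [abs_mul, abs_neg]
      _ = 2 * t * |x| * |gaussDeriv t (n + 1) x| + 2 * t * (n + 1) * |gaussDeriv t n x| := by
          rw [abs_mul, abs_mul (2 * t), abs_mul (2 * t * _),
            abs_of_nonneg (by positivity : 0 ≤ 2 * t),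
            abs_of_nonneg (by positivity : 0 ≤ 2 * t * ((n : ℝ) + 1))]
      _ ≤ 2 * c * (1 + x ^ 2) * (C₁ * (1 + x ^ 2) ^ (n + 1) * e) +
            2 * c * (n + 1) * (C₀ * (1 + x ^ 2) ^ (n + 2) * e) := by
          gcongr
          · exact h_abs x
          · exact h₁ t ht x
          · refine (h₀ t ht x).trans ?_
            gcongr
            omega
      _ = _ := by ring

lemma exists_pow_mul_exp_le {c : ℝ} (hc : 0 < c) (n : ℕ) :
    ∃ C, 0 ≤ C ∧ ∀ x : ℝ,
      (1 + x ^ 2) ^ n * Real.exp (-c * x ^ 2) ≤ C * Real.exp (-(c / 2) * x ^ 2) := by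
  refine ⟨n.factorial * (2 / c) ^ n * Real.exp (c / 2), by positivity, fun x => ?_⟩
  have h := Real.pow_div_factorial_le_exp (c / 2 * (1 + x ^ 2)) (by positivity) n
  rw [div_le_iff₀ (by positivity), mul_pow] at h
  calc (1 + x ^ 2) ^ n * Real.exp (-c * x ^ 2)
      = (2 / c) ^ n * ((c / 2) ^ n * (1 + x ^ 2) ^ n) * Real.exp (-c * x ^ 2) := by
        rw [← mul_assoc, ← mul_pow, div_mul_div_cancel₀ hc.ne', div_self two_ne_zero, one_pow,
          one_mul]
    _ ≤ (2 / c) ^ n * (Real.exp (c / 2 * (1 + x ^ 2)) * n.factorial) * Real.exp (-c * x ^ 2) := by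
        gcongr
    _ = n.factorial * (2 / c) ^ n * (Real.exp (c / 2 * (1 + x ^ 2)) * Real.exp (-c * x ^ 2)) := by
        ring
    _ = n.factorial * (2 / c) ^ n * (Real.exp (c / 2) * Real.exp (-(c / 2) * x ^ 2)) := by
        rw [← Real.exp_add, ← Real.exp_add]; ring_nf
    _ = _ := by ring

lemma exists_abs_gaussDeriv_mul_gaussDeriv_le {c : ℝ} (hc : 0 < c) (m n : ℕ) :
    ∃ C, 0 ≤ C ∧ ∀ t ∈ Set.Icc 0 c, ∀ x,
      |gaussDeriv t m x * gaussDeriv c n x| ≤ C * Real.exp (-(c / 2) * x ^ 2) := by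
  obtain ⟨C₁, hC₁, h₁⟩ := exists_abs_gaussDeriv_le hc.le m
  obtain ⟨C₂, hC₂, h₂⟩ := exists_abs_gaussDeriv_le hc.le n
  obtain ⟨C₃, hC₃, h₃⟩ := exists_pow_mul_exp_le hc (m + n)
  refine ⟨C₁ * C₂ * C₃, by positivity, fun t ht x => ?_⟩
  have h_exp : Real.exp (-t * x ^ 2) ≤ 1 :=
    Real.exp_le_one_iff.2 (by nlinarith [mul_nonneg ht.1 (sq_nonneg x)])
  calc |gaussDeriv t m x * gaussDeriv c n x|
      = |gaussDeriv t m x| * |gaussDeriv c n x| := abs_mul _ _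
    _ ≤ (C₁ * (1 + x ^ 2) ^ m * 1) * (C₂ * (1 + x ^ 2) ^ n * Real.exp (-c * x ^ 2)) := by
        gcongr
        · refine (h₁ t ht x).trans ?_
          gcongr
        · exact h₂ c ⟨hc.le, le_rfl⟩ x
    _ = C₁ * C₂ * ((1 + x ^ 2) ^ (m + n) * Real.exp (-c * x ^ 2)) := by ring
    _ ≤ C₁ * C₂ * (C₃ * Real.exp (-(c / 2) * x ^ 2)) := by
        gcongr C₁ * C₂ * ?_
        exact h₃ x
    _ = _ := by ring

lemma exists_abs_mulGaussDeriv_mul_gaussDeriv_le {c : ℝ} (hc : 0 < c) (m n : ℕ) :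
    ∃ C, 0 ≤ C ∧ ∀ t ∈ Set.Icc 0 c, ∀ x,
      |mulGaussDeriv t m x * gaussDeriv c n x| ≤ C * Real.exp (-(c / 2) * x ^ 2) := by
  have h_mul (x : ℝ) : x * gaussDeriv c n x =
      -(1 / (2 * c)) * gaussDeriv c (n + 1) x - n * gaussDeriv c (n - 1) x := by
    rw [gaussDeriv_succ]
    field_simp
    ring
  obtain ⟨C₁, hC₁, h₁⟩ := exists_abs_gaussDeriv_mul_gaussDeriv_le hc m (n + 1)
  obtain ⟨C₂, hC₂, h₂⟩ := exists_abs_gaussDeriv_mul_gaussDeriv_le hc m (n - 1)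
  obtain ⟨C₃, hC₃, h₃⟩ := exists_abs_gaussDeriv_mul_gaussDeriv_le hc (m - 1) n
  refine ⟨1 / (2 * c) * C₁ + n * C₂ + m * C₃, by positivity, fun t ht x => ?_⟩
  have key : mulGaussDeriv t m x * gaussDeriv c n x =
      -(1 / (2 * c)) * (gaussDeriv t m x * gaussDeriv c (n + 1) x)
        - n * (gaussDeriv t m x * gaussDeriv c (n - 1) x)
        + m * (gaussDeriv t (m - 1) x * gaussDeriv c n x) := by
    rw [mulGaussDeriv]
    linear_combination gaussDeriv t m x * h_mul x
  rw [key]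
  refine (abs_add_le _ _).trans ((add_le_add_left (abs_sub _ _) _).trans ?_)
  rw [abs_mul, abs_mul (n : ℝ), abs_mul (m : ℝ), abs_neg, Nat.abs_cast, Nat.abs_cast,
    abs_of_nonneg (by positivity : 0 ≤ 1 / (2 * c)), add_mul, add_mul, mul_assoc, mul_assoc,
    mul_assoc (m : ℝ)]
  gcongr
  · exact h₁ t ht x
  · exact h₂ t ht x
  · exact h₃ t ht x

lemma integrable_gaussDeriv_mul_gaussDeriv {c t : ℝ} (hc : 0 < c) (ht : t ∈ Set.Icc 0 c)
    (m n : ℕ) : Integrable fun x => gaussDeriv t m x * gaussDeriv c n x := by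
  obtain ⟨C, -, h⟩ := exists_abs_gaussDeriv_mul_gaussDeriv_le hc m n
  exact ((integrable_exp_neg_mul_sq (half_pos hc)).const_mul C).mono'
    (by fun_prop : Continuous _).aestronglyMeasurable (.of_forall fun x => h t ht x)

lemma integral_gaussDeriv_mul_gaussDeriv_succ {c t : ℝ} (hc : 0 < c) (ht : t ∈ Set.Icc 0 c)
    (m n : ℕ) : ∫ x, gaussDeriv t m x * gaussDeriv c (n + 1) x =
      -∫ x, gaussDeriv t (m + 1) x * gaussDeriv c n x :=
  integral_mul_deriv_eq_deriv_mul_of_integrable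
    (fun x _ => hasDerivAt_gaussDeriv t m x) (fun x _ => hasDerivAt_gaussDeriv c n x)
    (integrable_gaussDeriv_mul_gaussDeriv hc ht _ _)
    (integrable_gaussDeriv_mul_gaussDeriv hc ht _ _)
    (integrable_gaussDeriv_mul_gaussDeriv hc ht _ _)

lemma integral_gaussDeriv_mul_gaussDeriv {c t : ℝ} (hc : 0 < c) (ht : t ∈ Set.Icc 0 c)
    (m n : ℕ) : ∫ x, gaussDeriv t m x * gaussDeriv c n x =
      (-1) ^ n * ∫ x, gaussDeriv t (m + n) x * gaussDeriv c 0 x := by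
  induction n generalizing m with
  | zero => simp
  | succ n ih =>
    rw [integral_gaussDeriv_mul_gaussDeriv_succ hc ht, ih, add_right_comm, add_assoc]
    ring

lemma integral_gaussDeriv_succ_mul {c t : ℝ} (hc : 0 < c) (ht : t ∈ Set.Icc 0 c) (n : ℕ) :
    ∫ x, gaussDeriv t (n + 1) x * gaussDeriv c 0 x =
      -2 * n * (t * c / (t + c)) * ∫ x, gaussDeriv t (n - 1) x * gaussDeriv c 0 x := by
  have h_parts := integral_gaussDeriv_mul_gaussDeriv_succ hc ht n 0
  have h_pt (x : ℝ) : gaussDeriv t (n + 1) x * gaussDeriv c 0 x =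
      t / c * (gaussDeriv t n x * gaussDeriv c (0 + 1) x) -
        2 * t * n * (gaussDeriv t (n - 1) x * gaussDeriv c 0 x) := by
    rw [gaussDeriv_succ, gaussDeriv_succ c 0]
    field_simp
    simp
    ring
  have h_int : ∫ x, gaussDeriv t (n + 1) x * gaussDeriv c 0 x =
      t / c * (∫ x, gaussDeriv t n x * gaussDeriv c (0 + 1) x) -
        2 * t * n * ∫ x, gaussDeriv t (n - 1) x * gaussDeriv c 0 x := by
    simp_rw [h_pt]
    rw [integral_sub ((integrable_gaussDeriv_mul_gaussDeriv hc ht _ _).const_mul _)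
      ((integrable_gaussDeriv_mul_gaussDeriv hc ht _ _).const_mul _), integral_const_mul,
      integral_const_mul]
  rw [h_parts] at h_int
  have h_pos : 0 < t + c := add_pos_of_nonneg_of_pos ht.1 hc
  field_simp at h_int ⊢
  linarith

lemma integral_gaussDeriv_odd_mul {c t : ℝ} (hc : 0 < c) (ht : t ∈ Set.Icc 0 c) {n : ℕ}
    (hn : Odd n) : ∫ x, gaussDeriv t n x * gaussDeriv c 0 x = 0 := by
  obtain ⟨p, rfl⟩ := hn
  induction p with
  | zero => simpa using integral_gaussDeriv_succ_mul hc ht 0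
  | succ p ih =>
    rw [integral_gaussDeriv_succ_mul hc ht, show 2 * (p + 1) - 1 = 2 * p + 1 by omega, ih, mul_zero]

lemma integral_gaussDeriv_even_mul {c t : ℝ} (hc : 0 < c) (ht : t ∈ Set.Icc 0 c) (p : ℕ) :
    ∫ x, gaussDeriv t (2 * p) x * gaussDeriv c 0 x =
      √(π / (t + c)) * (-(t * c / (t + c))) ^ p * ((2 * p).factorial / p.factorial) := by
  induction p with
  | zero =>
    simp only [mul_zero, gaussDeriv_zero, ← Real.exp_add]
    rw [← integral_gaussian]
    simp
    congr! 3
    ring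
  | succ p ih =>
    rw [show 2 * (p + 1) = 2 * p + 1 + 1 by ring, integral_gaussDeriv_succ_mul hc ht,
      Nat.add_sub_cancel, ih, Nat.factorial_succ, Nat.factorial_succ, Nat.factorial_succ]
    have : (p.factorial : ℝ) ≠ 0 := by positivity
    push_cast
    field_simp
    ring

lemma hasDerivAt_intervalIntegral_of_continuous {f f' : ℝ → ℝ → ℝ}
    (hf : Continuous fun p : ℝ × ℝ => f p.1 p.2) (hf' : Continuous fun p : ℝ × ℝ => f' p.1 p.2)
    (h : ∀ x t, HasDerivAt (fun y => f y t) (f' x t) x) (a b x₀ : ℝ) :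
    HasDerivAt (fun x => ∫ t in a..b, f x t) (∫ t in a..b, f' x₀ t) x₀ := by
  obtain ⟨C, hC⟩ := ((isCompact_closedBall x₀ 1).prod (isCompact_uIcc (a := a) (b := b))
    ).exists_bound_of_continuousOn hf'.continuousOn
  have h_slice {g : ℝ → ℝ → ℝ} (hg : Continuous fun p : ℝ × ℝ => g p.1 p.2) (x : ℝ) :
      Continuous (g x) := hg.comp (Continuous.prodMk_right x)
  exact (intervalIntegral.hasDerivAt_integral_of_dominated_loc_of_deriv_le
    (bound := fun _ => C) (Metric.closedBall_mem_nhds x₀ one_pos)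
    (.of_forall fun x => (h_slice hf x).aestronglyMeasurable)
    ((h_slice hf x₀).intervalIntegrable _ _) (h_slice hf' x₀).aestronglyMeasurable
    (.of_forall fun t ht x hx => hC (x, t) ⟨hx, Set.uIoc_subset_uIcc ht⟩)
    intervalIntegrable_const (.of_forall fun t _ x _ => h x t)).2

lemma md_eq_of_hasDerivAt {Ψ : ℕ → ℕ → ℝ × ℝ → ℝ}
    (h₁ : ∀ m n x, HasDerivAt (fun s => Ψ m n (s, x.2)) (Ψ (m + 1) n x) x.1)
    (h₂ : ∀ m n x, HasDerivAt (fun s => Ψ m n (x.1, s)) (Ψ m (n + 1) x) x.2) (m n : ℕ) :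
    md m n (Ψ 0 0) = Ψ m n := by
  have h_snd : pd2^[n] (Ψ 0 0) = Ψ 0 n := by
    induction n with
    | zero => rfl
    | succ n ih =>
      rw [Function.iterate_succ_apply', ih]
      exact funext fun x => (h₂ 0 n x).deriv
  rw [md, h_snd]
  induction m with
  | zero => rfl
  | succ m ih =>
    rw [Function.iterate_succ_apply', ih]
    exact funext fun x => (h₁ m n x).deriv

lemma md_mul {f g : ℕ → ℝ → ℝ} (hf : ∀ n x, HasDerivAt (f n) (f (n + 1) x) x)
    (hg : ∀ n x, HasDerivAt (g n) (g (n + 1) x) x) (a : ℝ) (m n : ℕ) :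
    md m n (fun x => a * (f 0 x.1 * g 0 x.2)) = fun x => a * (f m x.1 * g n x.2) :=
  md_eq_of_hasDerivAt (Ψ := fun m n x => a * (f m x.1 * g n x.2))
    (fun m n x => ((hf m x.1).mul_const (g n x.2)).const_mul a)
    (fun m n x => ((hg n x.2).const_mul (f m x.1)).const_mul a) m n

lemma md_phi00 (lam : ℝ) (m n : ℕ) :
    md m n (phi00 lam) = fun x => 1 / (π * lam ^ 2) *
      (gaussDeriv (1 / lam ^ 2) m x.1 * gaussDeriv (1 / lam ^ 2) n x.2) := by
  rw [← md_mul (hasDerivAt_gaussDeriv _) (hasDerivAt_gaussDeriv _)]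
  congr 1
  ext x
  rw [phi00, gaussDeriv_zero, gaussDeriv_zero, ← Real.exp_add]
  ring_nf

lemma hpoly_eq (lam : ℝ) (k₁ k₂ : ℕ) (z : ℝ × ℝ) :
    hpoly lam k₁ k₂ z = hermiteOne (1 / lam ^ 2) k₁ z.1 * hermiteOne (1 / lam ^ 2) k₂ z.2 := by
  set c := 1 / lam ^ 2 with hc
  have h_shift (y : ℝ) (n : ℕ) (x : ℝ) : HasDerivAt (fun τ => gaussDeriv c n (τ - y))
      (gaussDeriv c (n + 1) (x - y)) x :=
    (hasDerivAt_gaussDeriv c n (x - y)).comp_sub_const x y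
  have h_gen : (fun τ : ℝ × ℝ => Real.exp
      ((2 * (τ.1 * z.1 + τ.2 * z.2) - (τ.1 ^ 2 + τ.2 ^ 2)) / lam ^ 2)) = fun τ =>
        Real.exp (c * z.1 ^ 2) * Real.exp (c * z.2 ^ 2) *
          (gaussDeriv c 0 (τ.1 - z.1) * gaussDeriv c 0 (τ.2 - z.2)) := by
    ext τ
    simp only [gaussDeriv_zero, ← Real.exp_add, hc]
    ring_nf
  rw [hpoly, h_gen, md_mul (h_shift z.1) (h_shift z.2)]
  simp only [zero_sub, gaussDeriv_neg, hermiteOne]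
  ring

lemma pd1_hpoly (lam : ℝ) (k₁ k₂ : ℕ) (x : ℝ × ℝ) :
    pd1 (hpoly lam k₁ k₂) x = 2 * (1 / lam ^ 2) * k₁ *
      (hermiteOne (1 / lam ^ 2) (k₁ - 1) x.1 * hermiteOne (1 / lam ^ 2) k₂ x.2) := by
  rw [funext (hpoly_eq lam k₁ k₂), pd1]
  dsimp only
  rw [((hasDerivAt_hermiteOne (1 / lam ^ 2) k₁ x.1).mul_const _).deriv, mul_assoc]

lemma V001_eq_integral (lam : ℝ) (x : ℝ × ℝ) :
    V001 lam x = -(1 / (2 * π)) *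
      ∫ t in (0 : ℝ)..1 / lam ^ 2, gaussDeriv t 0 x.1 * mulGaussDeriv t 0 x.2 := by
  set u := x.1 ^ 2 + x.2 ^ 2 with hu
  have h_integrand (t : ℝ) : gaussDeriv t 0 x.1 * mulGaussDeriv t 0 x.2 =
      x.2 * Real.exp (-u * t) := by
    simp only [mulGaussDeriv, gaussDeriv_zero, Nat.cast_zero, zero_mul, add_zero]
    rw [mul_left_comm, ← Real.exp_add]
    congr 2
    rw [hu]
    ring
  simp_rw [h_integrand]
  rw [intervalIntegral.integral_const_mul, V001, ← hu]
  rcases eq_or_ne u 0 with h | h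
  · have : x.2 = 0 := by nlinarith [sq_nonneg x.1, sq_nonneg x.2]
    simp [this]
  · rw [intervalIntegral.integral_comp_mul_left _ (neg_ne_zero.2 h), integral_exp]
    simp only [smul_eq_mul, mul_zero, Real.exp_zero]
    rw [show -u * (1 / lam ^ 2) = -u / lam ^ 2 by ring]
    field_simp
    ring

lemma md_V001 (lam : ℝ) (m n : ℕ) :
    md m n (V001 lam) = fun x => -(1 / (2 * π)) *
      ∫ t in (0 : ℝ)..1 / lam ^ 2, gaussDeriv t m x.1 * mulGaussDeriv t n x.2 := by
  rw [funext (V001_eq_integral lam)]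
  refine md_eq_of_hasDerivAt (Ψ := fun m n x => -(1 / (2 * π)) *
    ∫ t in (0 : ℝ)..1 / lam ^ 2, gaussDeriv t m x.1 * mulGaussDeriv t n x.2)
    (fun m n x => HasDerivAt.const_mul _ ?_) (fun m n x => HasDerivAt.const_mul _ ?_) m n
  · exact hasDerivAt_intervalIntegral_of_continuous
      (f := fun y t => gaussDeriv t m y * mulGaussDeriv t n x.2)
      (f' := fun y t => gaussDeriv t (m + 1) y * mulGaussDeriv t n x.2)
      (by fun_prop) (by fun_prop) (fun y t => (hasDerivAt_gaussDeriv t m y).mul_const _) _ _ _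
  · exact hasDerivAt_intervalIntegral_of_continuous
      (f := fun y t => gaussDeriv t m x.1 * mulGaussDeriv t n y)
      (f' := fun y t => gaussDeriv t m x.1 * mulGaussDeriv t (n + 1) y)
      (by fun_prop) (by fun_prop) (fun y t => (hasDerivAt_mulGaussDeriv t n y).const_mul _) _ _ _

section Pairing

variable {c : ℝ} (m₁ m₂ a₁ a₂ : ℕ)

lemma integrable_uncurry_gaussDeriv_mul (hc : 0 < c) :
    Integrable (Function.uncurry fun (x : ℝ × ℝ) (t : ℝ) =>
      gaussDeriv t m₁ x.1 * mulGaussDeriv t m₂ x.2 * (gaussDeriv c a₁ x.1 * gaussDeriv c a₂ x.2))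
      (volume.prod (volume.restrict (Set.Ioc 0 c))) := by
  obtain ⟨C₁, hC₁, h₁⟩ := exists_abs_gaussDeriv_mul_gaussDeriv_le hc m₁ a₁
  obtain ⟨C₂, hC₂, h₂⟩ := exists_abs_mulGaussDeriv_mul_gaussDeriv_le hc m₂ a₂
  have h_exp := integrable_exp_neg_mul_sq (half_pos hc)
  have h_bound : Integrable (fun p : (ℝ × ℝ) × ℝ =>
      C₁ * Real.exp (-(c / 2) * p.1.1 ^ 2) * (C₂ * Real.exp (-(c / 2) * p.1.2 ^ 2)) * 1)
      ((volume.prod volume).prod (volume.restrict (Set.Ioc 0 c))) :=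
    ((h_exp.const_mul C₁).mul_prod (h_exp.const_mul C₂)).mul_prod (integrable_const 1)
  refine h_bound.mono' (by unfold Function.uncurry; fun_prop : Continuous _).aestronglyMeasurable ?_
  filter_upwards [Measure.quasiMeasurePreserving_snd.ae (ae_restrict_mem measurableSet_Ioc)]
    with p hp
  have ht : p.2 ∈ Set.Icc 0 c := Set.Ioc_subset_Icc_self hp
  rw [Function.uncurry_def]
  dsimp only
  rw [mul_mul_mul_comm (gaussDeriv _ _ _), norm_mul, mul_one]
  exact mul_le_mul (h₁ _ ht _) (h₂ _ ht _) (norm_nonneg _) (by positivity)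

lemma integrable_integral_gaussDeriv_mul (hc : 0 < c) :
    Integrable fun x : ℝ × ℝ =>
      (∫ t in (0 : ℝ)..c, gaussDeriv t m₁ x.1 * mulGaussDeriv t m₂ x.2) *
        (gaussDeriv c a₁ x.1 * gaussDeriv c a₂ x.2) := by
  refine (integrable_uncurry_gaussDeriv_mul m₁ m₂ a₁ a₂ hc).integral_prod_left.congr
    (.of_forall fun x => ?_)
  simp only [Function.uncurry_apply_pair]
  rw [intervalIntegral.integral_of_le hc.le, integral_mul_const]

lemma integral_integral_gaussDeriv_mul (hc : 0 < c) :
    ∫ x : ℝ × ℝ, (∫ t in (0 : ℝ)..c, gaussDeriv t m₁ x.1 * mulGaussDeriv t m₂ x.2) *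
        (gaussDeriv c a₁ x.1 * gaussDeriv c a₂ x.2) =
      ∫ t in (0 : ℝ)..c, (∫ x, gaussDeriv t m₁ x * gaussDeriv c a₁ x) *
        ∫ x, mulGaussDeriv t m₂ x * gaussDeriv c a₂ x := by
  rw [intervalIntegral.integral_of_le hc.le]
  simp_rw [intervalIntegral.integral_of_le hc.le, ← integral_mul_const]
  rw [integral_integral_swap (integrable_uncurry_gaussDeriv_mul m₁ m₂ a₁ a₂ hc)]
  refine integral_congr_ae (.of_forall fun t => ?_)
  simp only
  rw [integral_mul_const, ← integral_prod_mul]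
  simp_rw [mul_mul_mul_comm]
  rfl

lemma integral_mulGaussDeriv_mul_gaussDeriv (hc : 0 < c) {t : ℝ} (ht : t ∈ Set.Ioc 0 c) :
    ∫ x, mulGaussDeriv t m₂ x * gaussDeriv c a₂ x =
      -(1 / (2 * t)) * ((-1) ^ a₂ * ∫ x, gaussDeriv t (m₂ + a₂ + 1) x * gaussDeriv c 0 x) := by
  have h_pt (x : ℝ) : mulGaussDeriv t m₂ x * gaussDeriv c a₂ x =
      -(1 / (2 * t)) * (gaussDeriv t (m₂ + 1) x * gaussDeriv c a₂ x) := by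
    have := ht.1.ne'
    rw [gaussDeriv_succ_eq_mulGaussDeriv]
    field_simp
  simp_rw [h_pt]
  rw [integral_const_mul, integral_gaussDeriv_mul_gaussDeriv hc (Set.Ioc_subset_Icc_self ht),
    add_right_comm]

lemma integral_pow_harmonic (hc : 0 < c) (n : ℕ) :
    ∫ t in (0 : ℝ)..c, (t * c / (t + c)) ^ n * (c / (t + c)) ^ 2 = (c / 2) ^ (n + 1) / (n + 1) := by
  have h_pos {t : ℝ} (ht : t ∈ Set.uIcc 0 c) : 0 < t + c := by
    rw [Set.uIcc_of_le hc.le] at ht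
    exact add_pos_of_nonneg_of_pos ht.1 hc
  have h_deriv : ∀ t ∈ Set.uIcc 0 c, HasDerivAt (fun t => (t * c / (t + c)) ^ (n + 1) / (n + 1))
      ((t * c / (t + c)) ^ n * (c / (t + c)) ^ 2) t := by
    intro t ht
    have := h_pos ht
    refine (((((hasDerivAt_id t).mul_const c).div ((hasDerivAt_id t).add_const c)
      this.ne').pow (n + 1)).div_const (n + 1)).congr_deriv ?_
    simp
    field_simp
    ring
  rw [intervalIntegral.integral_eq_sub_of_hasDerivAt h_deriv]
  · have : c * c / (c + c) = c / 2 := by field_simp; ring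
    simp [this]
  · refine ContinuousOn.intervalIntegrable fun t ht => ContinuousAt.continuousWithinAt ?_
    have := (h_pos ht).ne'
    fun_prop (disch := assumption)

end Pairing

lemma integral_V001_gaussDeriv_mul {lam : ℝ} (hlam : 0 < lam) (m₁ m₂ a₁ a₂ : ℕ) :
    -(1 / (2 * π)) * (1 / (π * lam ^ 2)) *
      (∫ x : ℝ × ℝ, (∫ t in (0 : ℝ)..1 / lam ^ 2, gaussDeriv t m₁ x.1 * mulGaussDeriv t m₂ x.2) *
        (gaussDeriv (1 / lam ^ 2) a₁ x.1 * gaussDeriv (1 / lam ^ 2) a₂ x.2)) =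
      (-1) ^ (a₁ + a₂) * Hone lam (m₁ + a₁) (m₂ + a₂) := by
  have h_norm : 1 / (π * lam ^ 2) = 1 / lam ^ 2 / π := by field_simp
  have h_half : 1 / (2 * lam ^ 2) = 1 / lam ^ 2 / 2 := by field_simp
  rw [Hone, h_norm, h_half]
  have hc : 0 < 1 / lam ^ 2 := by positivity
  generalize 1 / lam ^ 2 = c at hc
  rw [integral_integral_gaussDeriv_mul _ _ _ _ hc]
  have h_inner : ∀ t ∈ Set.uIoc 0 c, (∫ x, gaussDeriv t m₁ x * gaussDeriv c a₁ x) *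
      (∫ x, mulGaussDeriv t m₂ x * gaussDeriv c a₂ x) = -(1 / (2 * t)) * (-1) ^ (a₁ + a₂) *
        ((∫ x, gaussDeriv t (m₁ + a₁) x * gaussDeriv c 0 x) *
          ∫ x, gaussDeriv t (m₂ + a₂ + 1) x * gaussDeriv c 0 x) := by
    intro t ht
    rw [Set.uIoc_of_le hc.le] at ht
    rw [integral_mulGaussDeriv_mul_gaussDeriv _ _ hc ht,
      integral_gaussDeriv_mul_gaussDeriv hc (Set.Ioc_subset_Icc_self ht)]
    ring
  rw [intervalIntegral.integral_congr_ae (.of_forall h_inner)]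
  split_ifs with h
  · obtain ⟨⟨p, hp⟩, q, hq⟩ := h
    rw [← two_mul] at hp
    rw [hp, hq]
    have h_value : ∀ t ∈ Set.uIoc 0 c, -(1 / (2 * t)) * (-1) ^ (a₁ + a₂) *
        ((∫ x, gaussDeriv t (2 * p) x * gaussDeriv c 0 x) *
          ∫ x, gaussDeriv t (2 * q + 1 + 1) x * gaussDeriv c 0 x) =
        (-1) ^ (a₁ + a₂) * (-1) ^ (p + q) * (π / (2 * c)) * ((2 * p).factorial / p.factorial) *
          ((2 * (q + 1)).factorial / (q + 1).factorial) *
          ((t * c / (t + c)) ^ (p + q) * (c / (t + c)) ^ 2) := by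
      intro t ht
      rw [Set.uIoc_of_le hc.le] at ht
      have ht₀ := ht.1
      have h_sqrt := Real.mul_self_sqrt (by positivity : 0 ≤ π / (t + c))
      rw [show 2 * q + 1 + 1 = 2 * (q + 1) by ring,
        integral_gaussDeriv_even_mul hc (Set.Ioc_subset_Icc_self ht),
        integral_gaussDeriv_even_mul hc (Set.Ioc_subset_Icc_self ht)]
      calc _ = -(1 / (2 * t)) * (-1) ^ (a₁ + a₂) * (√(π / (t + c)) * √(π / (t + c))) *
            (-(t * c / (t + c))) ^ (p + q + 1) * ((2 * p).factorial / p.factorial) *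
            ((2 * (q + 1)).factorial / (q + 1).factorial) := by ring
        _ = _ := by
          rw [h_sqrt, neg_pow (t * c / (t + c)), pow_succ (t * c / (t + c)), pow_succ (-1)]
          generalize (t * c / (t + c)) ^ (p + q) = s
          field_simp
    rw [intervalIntegral.integral_congr_ae (.of_forall h_value),
      intervalIntegral.integral_const_mul, integral_pow_harmonic hc,
      show (2 * p + (2 * q + 1) + 1) / 2 = p + q + 1 by omega,
      show (2 * p + (2 * q + 1) - 1) / 2 = p + q by omega,
      show 2 * p / 2 = p by omega, Nat.cast_add_choose, Nat.factorial_succ (p + q),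
      show 2 * (q + 1) = 2 * q + 1 + 1 by ring, Nat.factorial_succ (2 * q + 1),
      Nat.factorial_succ q]
    have := hc.ne'
    push_cast
    field_simp
    ring
  · have h_zero : ∀ t ∈ Set.uIoc 0 c, -(1 / (2 * t)) * (-1) ^ (a₁ + a₂) *
        ((∫ x, gaussDeriv t (m₁ + a₁) x * gaussDeriv c 0 x) *
          ∫ x, gaussDeriv t (m₂ + a₂ + 1) x * gaussDeriv c 0 x) = 0 := by
      intro t ht
      rw [Set.uIoc_of_le hc.le] at ht
      rcases not_and_or.1 h with h | h
      · rw [integral_gaussDeriv_odd_mul hc (Set.Ioc_subset_Icc_self ht) (Nat.not_even_iff_odd.1 h)]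
        ring
      · rw [integral_gaussDeriv_odd_mul hc (Set.Ioc_subset_Icc_self ht)
          (Nat.not_odd_iff_even.1 h).add_one]
        ring
    rw [intervalIntegral.integral_congr_ae (.of_forall h_zero)]
    simp

/-- the combinatorial formula for `Γᴵ`. -/
theorem GammaI_combinatorial_formula (lam : ℝ) (hlam : 0 < lam)
    (k1 k2 l1 l2 m1 m2 : ℕ) :
    (∫ x : ℝ × ℝ, md m1 m2 (V001 lam) x * pd1 (hpoly lam k1 k2) x * md l1 l2 (phi00 lam) x)
      = ∑ i ∈ Finset.range (min l1 (k1 - 1) + 1), ∑ j ∈ Finset.range (min l2 k2 + 1),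
          (Nat.choose l1 i : ℝ) * (Nat.choose l2 j : ℝ) * (-1 : ℝ) ^ (l1 + l2)
            * (2 ^ (i + 1) * (Nat.descFactorial k1 (i + 1) : ℝ) / lam ^ (2 * (i + 1)))
            * (2 ^ j * (Nat.descFactorial k2 j : ℝ) / lam ^ (2 * j))
            * Hone lam (m1 + (k1 - (i + 1)) + (l1 - i)) (m2 + (k2 - j) + (l2 - j)) := by
  set c := 1 / lam ^ 2 with hc_def
  have hc : 0 < c := by positivity
  rcases k1 with _ | k
  · simp [pd1_hpoly]
  set A : ℕ → ℕ → ℝ := fun i j =>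
    2 * c * (k + 1) * ((l1.choose i : ℝ) * ((-1) ^ k * (2 * c) ^ i * k.descFactorial i)) *
      ((l2.choose j : ℝ) * ((-1) ^ k2 * (2 * c) ^ j * k2.descFactorial j)) with hA
  have h_integrand (x : ℝ × ℝ) :
      md m1 m2 (V001 lam) x * pd1 (hpoly lam (k + 1) k2) x * md l1 l2 (phi00 lam) x =
        ∑ i ∈ Finset.range (l1 + 1), ∑ j ∈ Finset.range (l2 + 1),
          (A i j * (-(1 / (2 * π)) * (1 / (π * lam ^ 2)))) *
            ((∫ t in (0 : ℝ)..c, gaussDeriv t m1 x.1 * mulGaussDeriv t m2 x.2) *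
              (gaussDeriv c (k - i + (l1 - i)) x.1 * gaussDeriv c (k2 - j + (l2 - j)) x.2)) := by
    rw [md_V001, pd1_hpoly, md_phi00, ← hc_def, Nat.add_sub_cancel]
    calc _ = -(1 / (2 * π)) * (1 / (π * lam ^ 2)) * (2 * c * (k + 1)) *
          (∫ t in (0 : ℝ)..c, gaussDeriv t m1 x.1 * mulGaussDeriv t m2 x.2) *
          ((hermiteOne c k x.1 * gaussDeriv c l1 x.1) *
            (hermiteOne c k2 x.2 * gaussDeriv c l2 x.2)) := by push_cast; ring
      _ = _ := by
        rw [hermiteOne_mul_gaussDeriv, hermiteOne_mul_gaussDeriv, Finset.sum_mul_sum,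
          Finset.mul_sum]
        refine Finset.sum_congr rfl fun i _ => ?_
        rw [Finset.mul_sum]
        refine Finset.sum_congr rfl fun j _ => ?_
        rw [hA]
        ring
  simp_rw [h_integrand]
  have h_int (i j : ℕ) := (integrable_integral_gaussDeriv_mul m1 m2 (k - i + (l1 - i))
    (k2 - j + (l2 - j)) hc).const_mul (A i j * (-(1 / (2 * π)) * (1 / (π * lam ^ 2))))
  rw [integral_finsetSum _ fun i _ => integrable_finsetSum _ fun j _ => h_int i j]
  have h_min (l k : ℕ) : Finset.range (min l k + 1) ⊆ Finset.range (l + 1) :=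
    Finset.range_subset_range.2 (by omega)
  have h_lt {l k i : ℕ} (hi : i ∈ Finset.range (l + 1)) (hi' : i ∉ Finset.range (min l k + 1)) :
      k < i := by
    simp only [Finset.mem_range] at hi hi'
    omega
  have h_sign {l k i : ℕ} (hi : i ∈ Finset.range (min l k + 1)) :
      (-1 : ℝ) ^ k * (-1) ^ (k - i + (l - i)) = (-1) ^ l := by
    have hi' : i ≤ l ∧ i ≤ k := by
      have := Finset.mem_range.1 hi
      omega
    rw [← pow_add, show k + (k - i + (l - i)) = l + 2 * (k - i) by omega, pow_add, pow_mul]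
    simp
  rw [Nat.add_sub_cancel, eq_comm]
  refine Finset.sum_subset_zero_on_sdiff (h_min l1 k) (fun i hi => ?_) (fun i hi => ?_)
  · obtain ⟨hi, hi'⟩ := Finset.mem_sdiff.1 hi
    simp [hA, Nat.descFactorial_of_lt (h_lt hi hi')]
  · rw [integral_finsetSum _ fun j _ => h_int i j]
    refine Finset.sum_subset_zero_on_sdiff (h_min l2 k2) (fun j hj => ?_) (fun j hj => ?_)
    · obtain ⟨hj, hj'⟩ := Finset.mem_sdiff.1 hj
      simp [hA, Nat.descFactorial_of_lt (h_lt hj hj')]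
    · rw [integral_const_mul, mul_assoc (A i j), hc_def, integral_V001_gaussDeriv_mul hlam,
        pow_add _ l1 l2, pow_add _ (k - i + (l1 - i)), ← h_sign hi, ← h_sign hj,
        Nat.add_sub_add_right, Nat.succ_descFactorial_succ, hA, ← add_assoc, ← add_assoc]
      have h_pow (a : ℝ) (n : ℕ) : a / lam ^ (2 * n) = a * c ^ n := by
        rw [hc_def, pow_mul, one_div_pow, div_eq_mul_one_div]
      rw [h_pow, h_pow]
      push_cast
      ring
end
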